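/- Let 𝒞 = {A_ξ : ξ ∈ ℝᵏ} be a collection of subsets of ℝᵈ of the form A_ξ = {z : Π(z, ξ) > 0}, where for each fixed z, Π(z, ·) is a polynomial of degree at most s in the k components of ξ. Then 𝒞 is a VC class with V(𝒞) ≤ 2k log₂(4es). -/

import Mathlib

/-- `n`-th shatter coefficient of a class `𝒞` of subsets of `Z`. -/
noncomputable def shatterCoef {Z : Type*} (𝒞 : Set (Set Z)) (n : ℕ) : ℕ :=
  ⨆ z : Fin n → Z, Set.ncard {f : Fin n → Bool | ∃ A ∈ 𝒞, ∀ i, f i = true ↔ z i ∈ A}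
namespace MvPolynomial

theorem totalDegree_pderiv_lt {σ R : Type*} [CommSemiring R] {D : ℕ} (hD : 0 < D)
    (p : MvPolynomial σ R) (hp : p.totalDegree ≤ D) (i : σ) :
    (pderiv i p).totalDegree < D := by
  classical
  rw [p.as_sum, map_sum]
  refine (totalDegree_finsetSum _ _).trans_lt ((Finset.sup_lt_iff hD).2 fun m hm => ?_)
  rw [pderiv_monomial]
  rcases Nat.eq_zero_or_pos (m i) with h0 | hpos
  · simpa [h0] using hD
  · refine (totalDegree_monomial_le _ _).trans_lt ?_
    have hle : Finsupp.single i 1 ≤ m := Finsupp.single_le_iff.2 hpos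
    have hm' : m.degree ≤ D := (le_totalDegree hm).trans hp
    have h1 : (m - Finsupp.single i 1).degree + 1 = m.degree := by
      conv_rhs => rw [← tsub_add_cancel_of_le hle]
      simp
    change (m - Finsupp.single i 1).degree < D
    omega

theorem exists_eval_eq_single {K σ : Type*} [Field K] (Z : Finset (σ → K)) (z : σ → K) :
    ∃ p : MvPolynomial σ K, eval z p = 1 ∧ ∀ w ∈ Z, w ≠ z → eval w p = 0 := by
  classical
  have hsep : ∀ w : σ → K, ∃ p : MvPolynomial σ K, w ≠ z → eval z p = 1 ∧ eval w p = 0 := by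
    intro w
    by_cases hwz : w = z
    · exact ⟨0, fun h => absurd hwz h⟩
    · obtain ⟨i, hi⟩ := Function.ne_iff.1 hwz
      have : z i - w i ≠ 0 := sub_ne_zero.2 (Ne.symm hi)
      exact ⟨C (z i - w i)⁻¹ * (X i - C (w i)), fun _ => by simp [this]⟩
  choose p hp using hsep
  refine ⟨∏ w ∈ Z.erase z, p w, ?_, fun w hw hwz => ?_⟩
  · rw [map_prod]
    exact Finset.prod_eq_one fun w hw => (hp w (Finset.ne_of_mem_erase hw)).1
  · rw [map_prod]
    exact Finset.prod_eq_zero (Finset.mem_erase.2 ⟨hwz, hw⟩) (hp w hwz).2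

/-- A system `x_i ^ D = R_i(x)` with `deg R_i < D` in `k` unknowns has at most `D ^ k`
solutions. -/
theorem card_le_of_pow_eq_eval {K σ : Type*} [Field K] [Fintype σ] {D : ℕ}
    (R : σ → MvPolynomial σ K) (hR : ∀ i, (R i).totalDegree < D) (Z : Finset (σ → K))
    (hZ : ∀ x ∈ Z, ∀ i, x i ^ D = eval x (R i)) : Z.card ≤ D ^ Fintype.card σ := by
  classical
  let ev : MvPolynomial σ K →ₗ[K] (Z → K) :=
    LinearMap.pi fun z => (aeval (z : σ → K)).toLinearMap
  have hev : ∀ p z, ev p z = eval (z : σ → K) p := fun p z => by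
    simp [ev, aeval_eq_eval]
  let mon : (σ → Fin D) → (Z → K) := fun m z => ∏ i, (z : σ → K) i ^ (m i : ℕ)
  let W := Submodule.span K (Set.range mon)
  have hW : ∀ N : ℕ, ∀ p : MvPolynomial σ K, p.totalDegree < N → ev p ∈ W := by
    intro N
    induction N with
    | zero => intro p hp; omega
    | succ N ih =>
      intro p hp
      rw [p.as_sum, map_sum]
      refine Submodule.sum_mem _ fun m hm => ?_
      have hdeg : m.degree ≤ N := by
        have : m.degree ≤ p.totalDegree := le_totalDegree hm
        omega
      by_cases hsmall : ∀ i, m i < D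
      · have : ev (monomial m (coeff m p)) = coeff m p • mon fun i => ⟨m i, hsmall i⟩ := by
          ext z
          simp [hev, mon, eval_monomial, Finsupp.prod_fintype]
        rw [this]
        exact W.smul_mem _ (Submodule.subset_span ⟨_, rfl⟩)
      · push Not at hsmall
        obtain ⟨i, hi⟩ := hsmall
        have hle : Finsupp.single i D ≤ m := by simpa [Finsupp.single_le_iff] using hi
        have hD : 0 < D := (Nat.zero_le _).trans_lt (hR i)
        have hm' : (m - Finsupp.single i D).degree + D = m.degree := by
          conv_rhs => rw [← tsub_add_cancel_of_le hle]
          simp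
        have : ev (monomial m (coeff m p)) =
            ev (monomial (m - Finsupp.single i D) (coeff m p) * R i) := by
          ext z
          rw [hev, hev, map_mul, ← hZ z z.2 i]
          have hsplit : monomial m (coeff m p) =
              monomial (m - Finsupp.single i D) (coeff m p) * X i ^ D := by
            rw [X_pow_eq_monomial, monomial_mul, mul_one, tsub_add_cancel_of_le hle]
          rw [hsplit, map_mul, map_pow, eval_X]
        rw [this]
        refine ih _ ((totalDegree_mul _ _).trans_lt ?_)
        have h1 : (monomial (m - Finsupp.single i D) (coeff m p)).totalDegree ≤
          (m - Finsupp.single i D).degree := totalDegree_monomial_le _ _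
        have := hR i
        omega
  have htop : W = ⊤ := by
    rw [eq_top_iff, ← (Pi.basisFun K Z).span_eq, Submodule.span_le]
    rintro _ ⟨z, rfl⟩
    obtain ⟨p, hp1, hp0⟩ := exists_eval_eq_single Z (z : σ → K)
    have hsingle : ev p = Pi.basisFun K Z z := by
      ext w
      rcases eq_or_ne w z with rfl | hwz
      · simp [hev, hp1]
      · simp [hev, hp0 w w.2 (fun h => hwz (Subtype.ext h)), hwz]
    exact hsingle ▸ hW _ p (Nat.lt_succ_self _)
  calc Z.card = Module.finrank K (Z → K) := by simp
    _ = Module.finrank K W := by rw [htop, finrank_top]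
    _ ≤ Fintype.card (σ → Fin D) := finrank_range_le_card mon
    _ = D ^ Fintype.card σ := by simp

theorem hasDerivAt_eval_update {σ : Type*} [DecidableEq σ] (p : MvPolynomial σ ℝ) (x : σ → ℝ)
    (i : σ) (t : ℝ) :
    HasDerivAt (fun u => eval (Function.update x i u) p)
      (eval (Function.update x i t) (pderiv i p)) t := by
  induction p using MvPolynomial.induction_on with
  | C a => simpa using hasDerivAt_const t a
  | add p q hp hq => simpa [Pi.add_def] using hp.fun_add hq
  | mul_X p j hp =>
    have hX : HasDerivAt (fun u => eval (Function.update x i u) (X j : MvPolynomial σ ℝ))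
        (eval (Function.update x i t) (pderiv i (X j : MvPolynomial σ ℝ))) t := by
      rcases eq_or_ne j i with rfl | hji
      · simpa using hasDerivAt_id' t
      · simpa [pderiv_X_of_ne hji, hji] using hasDerivAt_const t (x j)
    have := hp.mul hX
    simp only [Pi.mul_def, ← map_mul] at this
    refine this.congr_deriv ?_
    rw [pderiv_mul, map_add]

theorem eval_pderiv_eq_zero_of_isLocalMin {σ : Type*} (p : MvPolynomial σ ℝ) {x : σ → ℝ}
    (hx : IsLocalMin (fun y => eval y p) x) (i : σ) : eval x (pderiv i p) = 0 := by
  classical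
  have h := p.hasDerivAt_eval_update x i (x i)
  rw [Function.update_eq_self] at h
  refine IsLocalMin.hasDerivAt_eq_zero ?_ h
  have hc : ContinuousAt (fun u => Function.update x i u) (x i) := by fun_prop
  have : Filter.Tendsto (fun u => Function.update x i u) (nhds (x i)) (nhds x) := by
    simpa [ContinuousAt] using hc
  have := this.eventually hx
  simpa [IsLocalMin, IsMinFilter] using this

end MvPolynomial

open Filter Topology in
theorem IsCompact.eventually_lt_add_mul {X : Type*} [TopologicalSpace X] {K : Set X}
    (hK : IsCompact K) {φ h : X → ℝ} (hφ : Continuous φ) (hh : Continuous h)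
    (hφ0 : ∀ y, 0 ≤ φ y) (hh0 : ∀ y, 0 ≤ h y) {c : ℝ} (hc : ∀ y ∈ K, h y = 0 → c < φ y) :
    ∀ᶠ M : ℝ in atTop, ∀ y ∈ K, c < φ y + M * h y := by
  have hK' : IsCompact (K ∩ {y | φ y ≤ c}) := hK.inter_right (isClosed_le hφ continuous_const)
  rcases (K ∩ {y | φ y ≤ c}).eq_empty_or_nonempty with he | hne
  · filter_upwards [eventually_ge_atTop (0 : ℝ)] with M hM y hy
    have : c < φ y := by
      by_contra! hle
      exact (he ▸ (⟨hy, hle⟩ : y ∈ K ∩ {y | φ y ≤ c}) : y ∈ (∅ : Set X))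
    linarith [mul_nonneg hM (hh0 y)]
  · obtain ⟨z, hz, hmin⟩ := hK'.exists_isMinOn hne hh.continuousOn
    have hpos : 0 < h z := lt_of_le_of_ne (hh0 z) fun h0 =>
      absurd (hc z hz.1 h0.symm) (not_lt.2 hz.2)
    filter_upwards [eventually_ge_atTop (0 : ℝ), eventually_gt_atTop (c / h z)] with M hM hM' y hy
    rcases lt_or_ge c (φ y) with hlt | hle
    · linarith [mul_nonneg hM (hh0 y)]
    · have h1 : h z ≤ h y := hmin ⟨hy, hle⟩
      have h2 : c < M * h z := (div_lt_iff₀ hpos).1 hM'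
      have h3 : M * h z ≤ M * h y := mul_le_mul_of_nonneg_left h1 hM
      linarith [hφ0 y]

theorem exists_isMinOn_maximal_active {X ι : Type*} [TopologicalSpace X] [Fintype ι]
    {φ : X → ℝ} {g : ι → X → ℝ} (hφ : Continuous φ) (hg : ∀ i, Continuous (g i))
    (hcpt : ∀ r, IsCompact {x | φ x ≤ r}) (hne : ∃ x, ∀ i, 0 ≤ g i x) :
    ∃ x, ∃ I : Finset ι, (∀ i, 0 ≤ g i x) ∧ (∀ i, i ∈ I ↔ g i x = 0) ∧
      ∀ y, (∀ i, 0 ≤ g i y) → (∀ i ∈ I, g i y = 0) → (∃ i, i ∉ I ∧ g i y = 0) → φ x < φ y := by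
  classical
  obtain ⟨ξ, hξ⟩ := hne
  have hclosed : IsClosed {x | ∀ i, 0 ≤ g i x} := by
    simp only [Set.ofPred_forall]
    exact isClosed_iInter fun i => isClosed_le continuous_const (hg i)
  obtain ⟨x₀, hx₀, hmin₀⟩ := ((hcpt (φ ξ)).inter_right hclosed).exists_isMinOn
    ⟨ξ, le_refl (φ ξ), hξ⟩ hφ.continuousOn
  have hmin : ∀ y, (∀ i, 0 ≤ g i y) → φ x₀ ≤ φ y := fun y hy => by
    rcases le_total (φ y) (φ ξ) with h | h
    · exact hmin₀ ⟨h, hy⟩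
    · exact hx₀.1.trans h
  let act : X → Finset ι := fun x => Finset.univ.filter fun i => g i x = 0
  let A : Set (Finset ι) := act '' {x | (∀ i, 0 ≤ g i x) ∧ φ x = φ x₀}
  obtain ⟨I, hI⟩ := (Set.toFinite A).exists_maximal ⟨_, x₀, ⟨hx₀.2, rfl⟩, rfl⟩
  obtain ⟨x, ⟨hx, hφx⟩, rfl⟩ := hI.1
  refine ⟨x, act x, hx, by simp [act], fun y hy hIy ⟨i, hi, hiy⟩ => ?_⟩
  refine lt_of_le_of_ne (hφx ▸ hmin y hy) fun heq => hi ?_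
  have hle : act x ≤ act y := fun j hj => by simpa [act] using hIy j hj
  exact hI.2 ⟨y, ⟨hy, heq ▸ hφx⟩, rfl⟩ hle (by simpa [act] using hiy)

namespace MvPolynomial

open Filter Topology in
/-- A real polynomial of degree at most `D` has at most `D ^ k` local minima that are separated
by bounded open sets on whose frontiers its values are larger. -/
theorem card_le_of_lt_frontier {σ ι : Type*} [Fintype σ] (Q : MvPolynomial σ ℝ) {D : ℕ}
    (hD : 0 < D) (hQ : Q.totalDegree ≤ D) (T : Finset ι) (U : ι → Set (σ → ℝ)) (x : ι → σ → ℝ)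
    (hUo : ∀ i ∈ T, IsOpen (U i)) (hUb : ∀ i ∈ T, Bornology.IsBounded (U i))
    (hdisj : ∀ i ∈ T, ∀ j ∈ T, i ≠ j → Disjoint (U i) (U j)) (hx : ∀ i ∈ T, x i ∈ U i)
    (hlt : ∀ i ∈ T, ∀ y ∈ frontier (U i), eval (x i) Q < eval y Q) :
    T.card ≤ D ^ Fintype.card σ := by
  classical
  let H : MvPolynomial σ ℝ := ∑ a, X a ^ (D + 1)
  have hev : ∀ᶠ t : ℝ in 𝓝 0, ∀ i ∈ T, ∀ y ∈ frontier (U i),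
      eval (x i) Q + t * eval (x i) H < eval y Q + t * eval y H := by
    refine (eventually_all_finset T).2 fun i hi => ?_
    have hK : IsCompact (frontier (U i)) := Metric.isCompact_of_isClosed_isBounded
      isClosed_frontier ((hUb i hi).closure.subset frontier_subset_closure)
    refine hK.eventually_forall_of_forall_eventually fun y hy => ?_
    have h1 : Continuous fun z : ℝ × (σ → ℝ) => eval (x i) Q + z.1 * eval (x i) H := by fun_prop
    have h2 : Continuous fun z : ℝ × (σ → ℝ) => eval z.2 Q + z.1 * eval z.2 H :=
      (Q.continuous_eval.comp continuous_snd).add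
        (continuous_fst.mul (H.continuous_eval.comp continuous_snd))
    exact (isOpen_lt h1 h2).mem_nhds (by simpa using hlt i hi y hy)
  obtain ⟨t, ht, htpos⟩ : ∃ t : ℝ, (∀ i ∈ T, ∀ y ∈ frontier (U i),
      eval (x i) Q + t * eval (x i) H < eval y Q + t * eval y H) ∧ 0 < t :=
    ((hev.filter_mono nhdsWithin_le_nhds).and
      (self_mem_nhdsWithin : Set.Ioi (0 : ℝ) ∈ 𝓝[>] 0)).exists
  let P := Q + C t * H
  have hP : ∀ y, eval y P = eval y Q + t * eval y H := fun y => by simp [P]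
  have hz : ∀ i, ∃ z, i ∈ T → z ∈ U i ∧ IsLocalMin (fun y => eval y P) z := by
    intro i
    by_cases hi : i ∈ T
    · have hK : IsCompact (closure (U i)) := (hUb i hi).isCompact_closure
      obtain ⟨z, hz, hmin⟩ := hK.exists_isMinOn ⟨x i, subset_closure (hx i hi)⟩
        P.continuous_eval.continuousOn
      have hzU : z ∈ U i := by
        by_contra hzU
        have hfr : z ∈ frontier (U i) := by
          rw [(hUo i hi).frontier_eq]
          exact ⟨hz, hzU⟩
        have h1 := ht i hi z hfr
        have h2 : eval z P ≤ eval (x i) P := hmin (subset_closure (hx i hi))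
        rw [hP, hP] at h2
        exact absurd h1 (not_lt.2 h2)
      exact ⟨z, fun _ => ⟨hzU, (hmin.on_subset subset_closure).isLocalMin
        ((hUo i hi).mem_nhds hzU)⟩⟩
    · exact ⟨0, fun h => absurd h hi⟩
  choose z hz using hz
  have hinj : Set.InjOn z T := fun i hi j hj hij => by
    by_contra hne
    exact Set.disjoint_left.1 (hdisj i hi j hj hne) (hz i hi).1 (hij ▸ (hz j hj).1)
  rw [← Finset.card_image_of_injOn hinj]
  have htD : t * ((D : ℝ) + 1) ≠ 0 := by positivity
  refine card_le_of_pow_eq_eval (fun a => C (-(t * ((D : ℝ) + 1))⁻¹) * pderiv a Q)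
    (fun a => ?_) _ fun w hw a => ?_
  · refine (totalDegree_mul _ _).trans_lt ?_
    rw [totalDegree_C, zero_add]
    exact totalDegree_pderiv_lt hD Q hQ a
  · obtain ⟨i, hi, rfl⟩ := Finset.mem_image.1 hw
    have h0 := eval_pderiv_eq_zero_of_isLocalMin P (hz i hi).2 a
    have hH : pderiv a H = C ((D : ℝ) + 1) * X a ^ D := by
      simp only [H, map_sum]
      rw [Finset.sum_eq_single a]
      · simp
      · intro b _ hb
        simp [pderiv_X_of_ne hb]
      · simp
    have hPd : pderiv a P = pderiv a Q + C t * (C ((D : ℝ) + 1) * X a ^ D) := by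
      simp [P, hH]
    rw [hPd] at h0
    simp only [map_add, map_mul, map_pow, eval_C, eval_X] at h0 ⊢
    field_simp
    linarith

theorem exists_levels_card_le {σ ι : Type*} [Fintype σ] [Fintype ι] (f : ι → MvPolynomial σ ℝ)
    (s : ι × Bool → Set ℝ) (hs : ∀ p, (s p).Infinite) :
    ∃ c : ι × Bool → ℝ, (∀ p, c p ∈ s p) ∧ ∀ (τ : ι → Bool) (I : Finset ι) (x : σ → ℝ),
      (∀ i ∈ I, eval x (f i) = c (i, τ i)) → I.card ≤ Fintype.card σ := by
  classical
  have hdep : ∀ I : Finset ι, ∃ P : MvPolynomial I ℝ, P ≠ 0 ∧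
      (Fintype.card σ < I.card → aeval (fun i : I => f i) P = 0) := by
    intro I
    by_cases hI : Fintype.card σ < I.card
    · have hnot : ¬ AlgebraicIndependent ℝ fun i : I => f i := fun h => by
        have := h.lift_cardinalMk_le_trdeg
        rw [trdeg_of_isDomain] at this
        simp only [Cardinal.mk_fintype, Cardinal.lift_natCast, Nat.cast_le,
          Fintype.card_coe] at this
        omega
      rw [algebraicIndependent_iff] at hnot
      push Not at hnot
      obtain ⟨P, hP, hP0⟩ := hnot
      exact ⟨P, hP0, fun _ => hP⟩
    · exact ⟨1, one_ne_zero, fun h => absurd h hI⟩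
  choose P hP0 hP using hdep
  let G : MvPolynomial (ι × Bool) ℝ := ∏ I : Finset ι, ∏ τ : ι → Bool,
    rename (fun i : I => ((i : ι), τ i)) (P I)
  have hG : G ≠ 0 := Finset.prod_ne_zero_iff.2 fun I _ => Finset.prod_ne_zero_iff.2 fun τ _ => by
    have hinj : Function.Injective fun i : I => ((i : ι), τ i) := fun i j hij =>
      Subtype.ext (Prod.ext_iff.1 hij).1
    exact fun h => hP0 I (rename_injective _ hinj (by rw [h, map_zero]))
  obtain ⟨c, hc, hGc⟩ : ∃ c, c ∈ Set.pi .univ s ∧ eval c G ≠ 0 := by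
    by_contra! h
    exact hG (funext_set s hs fun x hx => by rw [h x hx, map_zero])
  refine ⟨c, fun p => hc p trivial, fun τ I x hx => ?_⟩
  by_contra! hI
  refine hGc ?_
  simp only [G, map_prod]
  refine Finset.prod_eq_zero (Finset.mem_univ I) (Finset.prod_eq_zero (Finset.mem_univ τ) ?_)
  rw [eval_rename]
  have h1 : (c ∘ fun i : I => ((i : ι), τ i)) = fun i : I => eval x (f i) :=
    _root_.funext fun i => (hx i i.2).symm
  rw [h1]
  have h2 := congrArg (eval x) (hP I hI)
  rw [map_zero] at h2
  rw [← h2, ← coe_aeval_eq_eval, ← coe_aeval_eq_eval, RingHom.coe_coe, RingHom.coe_coe,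
    comp_aeval_apply]

end MvPolynomial

theorem isCompact_setOf_sum_sq_le {σ : Type*} [Fintype σ] (r : ℝ) :
    IsCompact {x : σ → ℝ | ∑ a, x a ^ 2 ≤ r} := by
  refine Metric.isCompact_of_isClosed_isBounded
    (isClosed_le (by fun_prop) continuous_const) ?_
  refine (Metric.isBounded_closedBall (x := (0 : σ → ℝ)) (r := √r)).subset fun x hx => ?_
  rw [mem_closedBall_zero_iff, pi_norm_le_iff_of_nonneg (Real.sqrt_nonneg r)]
  intro a
  rw [Real.norm_eq_abs]
  refine Real.abs_le_sqrt (le_trans ?_ hx)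
  exact Finset.single_le_sum (f := fun a => x a ^ 2) (fun _ _ => sq_nonneg _) (Finset.mem_univ a)

theorem exists_pos_lt_of_finset {α : Type*} (S : Finset α) (u : α → ℝ) :
    ∃ ε : ℝ, 0 < ε ∧ ∀ a ∈ S, 0 < u a → ε < u a := by
  have h : ∀ᶠ ε : ℝ in nhdsWithin 0 (Set.Ioi 0), ∀ a ∈ S, 0 < u a → ε < u a := by
    refine (Filter.eventually_all_finset S).2 fun a _ => ?_
    by_cases ha : 0 < u a
    · filter_upwards [nhdsWithin_le_nhds (Iio_mem_nhds ha)] with ε hε _ using hε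
    · exact Filter.Eventually.of_forall fun _ h => absurd h ha
  obtain ⟨ε, h1, h2⟩ := (h.and self_mem_nhdsWithin).exists
  exact ⟨ε, h2, h1⟩

namespace MvPolynomial

/-- Warren's bound on the number of sign patterns of finitely many real polynomials. -/
theorem card_signPatterns_le {σ ι : Type*} [Fintype σ] [Fintype ι] {s : ℕ} (hs : 1 ≤ s)
    (f : ι → MvPolynomial σ ℝ) (hf : ∀ i, (f i).totalDegree ≤ s) (S : Finset (ι → Bool))
    (hS : ∀ τ ∈ S, ∃ ξ, ∀ i, τ i = true ↔ 0 < eval ξ (f i)) :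
    S.card ≤ (4 * s) ^ Fintype.card σ *
      (Finset.univ.filter fun I : Finset ι => I.card ≤ Fintype.card σ).card := by
  classical
  have hS' : ∀ τ, ∃ ξ, τ ∈ S → ∀ i, τ i = true ↔ 0 < eval ξ (f i) := fun τ => by
    by_cases h : τ ∈ S
    · exact (hS τ h).imp fun ξ hξ _ => hξ
    · exact ⟨0, fun h' => absurd h' h⟩
  choose ξ hξ using hS'
  obtain ⟨ε, hε, hεlt⟩ := exists_pos_lt_of_finset (S ×ˢ (Finset.univ : Finset ι))
    fun q => eval (ξ q.1) (f q.2)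
  obtain ⟨c, hc, hgen⟩ := exists_levels_card_le f
    (fun p => if p.2 then Set.Ioo (ε / 2) ε else Set.Ioo 0 (ε / 2)) fun p => by
      rcases p with ⟨i, _ | _⟩
      · simpa using Set.Ioo_infinite (half_pos hε)
      · simpa using Set.Ioo_infinite (half_lt_self hε)
  have hctrue : ∀ i, ε / 2 < c (i, true) ∧ c (i, true) < ε := fun i => by simpa using hc (i, true)
  have hcfalse : ∀ i, 0 < c (i, false) ∧ c (i, false) < ε / 2 := fun i => by
    simpa using hc (i, false)
  let sg : Bool → ℝ := fun b => if b then 1 else -1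
  have hsg : ∀ b, sg b ≠ 0 := by rintro (_ | _) <;> simp [sg]
  let g : (ι → Bool) → ι → (σ → ℝ) → ℝ := fun τ i x => sg (τ i) * (eval x (f i) - c (i, τ i))
  have hg0 : ∀ τ i x, g τ i x = 0 ↔ eval x (f i) = c (i, τ i) := fun τ i x => by
    simp [g, hsg, sub_eq_zero]
  have hgcont : ∀ τ i, Continuous (g τ i) := fun τ i =>
    continuous_const.mul ((f i).continuous_eval.sub continuous_const)
  have hgdisj : ∀ τ τ' i x, τ i ≠ τ' i → 0 < g τ i x → 0 < g τ' i x → False := by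
    intro τ τ' i x hne h1 h2
    have ht := hctrue i
    have hf := hcfalse i
    cases h : τ i <;> cases h' : τ' i <;> simp [g, sg, h, h'] at h1 h2 hne <;> linarith
  let φ : (σ → ℝ) → ℝ := fun x => ∑ a, x a ^ 2
  have hφc : Continuous φ := by fun_prop
  have hφ0 : ∀ x, 0 ≤ φ x := fun x => Finset.sum_nonneg fun _ _ => sq_nonneg _
  have hmin : ∀ τ, ∃ x, ∃ I : Finset ι, τ ∈ S →
      (∀ i, 0 ≤ g τ i x) ∧ (∀ i, i ∈ I ↔ g τ i x = 0) ∧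
      ∀ y, (∀ i, 0 ≤ g τ i y) → (∀ i ∈ I, g τ i y = 0) → (∃ i, i ∉ I ∧ g τ i y = 0) →
        φ x < φ y := by
    intro τ
    by_cases hτ : τ ∈ S
    · obtain ⟨x, I, h⟩ := exists_isMinOn_maximal_active hφc (hgcont τ)
        isCompact_setOf_sum_sq_le ⟨ξ τ, fun i => by
          have h1 := hξ τ hτ i
          have h2 := hεlt (τ, i) (by simp [hτ])
          have ht := hctrue i
          have hf := hcfalse i
          cases h : τ i
          · simp only [h, Bool.false_eq_true, false_iff, not_lt] at h1
            simp [g, sg, h]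
            linarith
          · have := h2 (h1.1 h)
            simp [g, sg, h]
            linarith⟩
      exact ⟨x, I, fun _ => h⟩
    · exact ⟨0, ∅, fun h => absurd h hτ⟩
  choose x I hxI using hmin
  have hIcard : ∀ τ ∈ S, (I τ).card ≤ Fintype.card σ := fun τ hτ =>
    hgen τ (I τ) (x τ) fun i hi => (hg0 τ i _).1 (((hxI τ hτ).2.1 i).1 hi)
  let lab : (ι → Bool) → Σ _ : Finset ι, Finset ι := fun τ =>
    ⟨I τ, (I τ).filter fun i => τ i = true⟩
  let B : Finset (Σ _ : Finset ι, Finset ι) :=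
    (Finset.univ.filter fun J : Finset ι => J.card ≤ Fintype.card σ).sigma fun J => J.powerset
  have hlab : ∀ τ ∈ S, lab τ ∈ B := fun τ hτ => by
    simp [lab, B, hIcard τ hτ, Finset.filter_subset]
  have hBcard : B.card ≤ 2 ^ Fintype.card σ *
      (Finset.univ.filter fun J : Finset ι => J.card ≤ Fintype.card σ).card := by
    rw [Finset.card_sigma, mul_comm, ← smul_eq_mul]
    refine Finset.sum_le_card_nsmul _ _ _ fun J hJ => ?_
    rw [Finset.card_powerset]
    exact Nat.pow_le_pow_right two_pos (Finset.mem_filter.1 hJ).2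
  have hfib : ∀ b ∈ B, (S.filter fun τ => lab τ = b).card ≤ (2 * s) ^ Fintype.card σ := by
    rintro b -
    rcases (S.filter fun τ => lab τ = b).eq_empty_or_nonempty with he | ⟨τ₀, hτ₀⟩
    · simp [he]
    obtain ⟨hτ₀S, rfl⟩ := Finset.mem_filter.1 hτ₀
    set T := S.filter fun τ => lab τ = lab τ₀ with hT
    have hTS : ∀ τ ∈ T, τ ∈ S := fun τ hτ => (Finset.mem_filter.1 hτ).1
    have hTI : ∀ τ ∈ T, I τ = I τ₀ := fun τ hτ =>
      congrArg Sigma.fst (Finset.mem_filter.1 hτ).2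
    have hTτ : ∀ τ ∈ T, ∀ i ∈ I τ₀, τ i = τ₀ i := fun τ hτ i hi => by
      have h1 : (I τ).filter (fun i => τ i = true) = (I τ₀).filter (fun i => τ₀ i = true) :=
        congrArg (fun p : Σ _ : Finset ι, Finset ι => p.2) (Finset.mem_filter.1 hτ).2
      have h2 := Finset.ext_iff.1 h1 i
      simp only [Finset.mem_filter, hTI τ hτ, hi, true_and] at h2
      exact Bool.eq_iff_iff.2 h2
    let hpen : (σ → ℝ) → ℝ := fun y => ∑ i ∈ I τ₀, (eval y (f i) - c (i, τ₀ i)) ^ 2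
    have hpenc : Continuous hpen := continuous_finsetSum _ fun i _ =>
      ((f i).continuous_eval.sub continuous_const).pow 2
    have hpen0 : ∀ y, 0 ≤ hpen y := fun y => Finset.sum_nonneg fun _ _ => sq_nonneg _
    have hpenz : ∀ τ ∈ T, ∀ y, hpen y = 0 ↔ ∀ i ∈ I τ, g τ i y = 0 := by
      intro τ hτ y
      rw [Finset.sum_eq_zero_iff_of_nonneg fun _ _ => sq_nonneg _, hTI τ hτ]
      refine forall₂_congr fun i hi => ?_
      rw [hg0, hTτ τ hτ i hi, sq_eq_zero_iff, sub_eq_zero]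
    obtain ⟨r, hr⟩ : ∃ r, ∀ τ ∈ T, φ (x τ) < r :=
      ((Filter.eventually_all_finset T).2 fun τ _ => Filter.eventually_gt_atTop (φ (x τ))).exists
    let U : (ι → Bool) → Set (σ → ℝ) := fun τ => {y | (∀ i ∉ I τ, 0 < g τ i y) ∧ φ y < r}
    have hUo : ∀ τ, IsOpen (U τ) := fun τ => by
      have h1 : IsOpen {y | ∀ i ∉ I τ, 0 < g τ i y} := by
        simp only [Set.ofPred_forall]
        exact isOpen_iInter_of_finite fun i => isOpen_iInter_of_finite fun _ =>
          isOpen_lt continuous_const (hgcont τ i)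
      exact h1.inter (isOpen_lt hφc continuous_const)
    have hUb : ∀ τ, Bornology.IsBounded (U τ) := fun τ =>
      (isCompact_setOf_sum_sq_le r).isBounded.subset fun y hy => le_of_lt hy.2
    have hUcl : ∀ τ, closure (U τ) ⊆ {y | (∀ i ∉ I τ, 0 ≤ g τ i y) ∧ φ y ≤ r} := fun τ => by
      have h1 : IsClosed {y | ∀ i ∉ I τ, 0 ≤ g τ i y} := by
        simp only [Set.ofPred_forall]
        exact isClosed_iInter fun i => isClosed_iInter fun _ =>
          isClosed_le continuous_const (hgcont τ i)
      exact closure_minimal (fun y hy => ⟨fun i hi => (hy.1 i hi).le, hy.2.le⟩)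
        (h1.inter (isClosed_le hφc continuous_const))
    have hxU : ∀ τ ∈ T, x τ ∈ U τ := fun τ hτ => by
      obtain ⟨h1, h2, -⟩ := hxI τ (hTS τ hτ)
      exact ⟨fun i hi => lt_of_le_of_ne (h1 i) fun h => hi ((h2 i).2 h.symm), hr τ hτ⟩
    have hfront : ∀ τ ∈ T, ∀ y ∈ frontier (U τ), hpen y = 0 → φ (x τ) < φ y := by
      intro τ hτ y hy hpy
      rw [(hUo τ).frontier_eq] at hy
      obtain ⟨hycl, hyU⟩ := hy
      obtain ⟨h1, h2⟩ := hUcl τ hycl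
      obtain ⟨-, -, h3⟩ := hxI τ (hTS τ hτ)
      have hact := (hpenz τ hτ y).1 hpy
      rcases h2.lt_or_eq with hlt | heq
      · refine h3 y (fun i => ?_) hact ?_
        · by_cases hi : i ∈ I τ
          · exact (hact i hi).ge
          · exact h1 i hi
        · by_contra! hne
          exact hyU ⟨fun i hi => lt_of_le_of_ne (h1 i hi) (hne i hi).symm, hlt⟩
      · exact heq ▸ hr τ hτ
    obtain ⟨M, hM⟩ : ∃ M : ℝ, ∀ τ ∈ T, ∀ y ∈ frontier (U τ), φ (x τ) < φ y + M * hpen y :=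
      ((Filter.eventually_all_finset T).2 fun τ hτ =>
        (Metric.isCompact_of_isClosed_isBounded isClosed_frontier
          ((hUb τ).closure.subset frontier_subset_closure)).eventually_lt_add_mul
          hφc hpenc hφ0 hpen0 (hfront τ hτ)).exists
    let Q : MvPolynomial σ ℝ := ∑ a, X a ^ 2 + C M * ∑ i ∈ I τ₀, (f i - C (c (i, τ₀ i))) ^ 2
    have hQ : ∀ y, eval y Q = φ y + M * hpen y := fun y => by simp [Q, φ, hpen]
    have hQdeg : Q.totalDegree ≤ 2 * s := by
      refine (totalDegree_add _ _).trans (max_le ?_ ((totalDegree_mul _ _).trans ?_))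
      · refine totalDegree_finsetSum_le fun a _ => ?_
        rw [totalDegree_X_pow]
        omega
      · rw [totalDegree_C, zero_add]
        refine totalDegree_finsetSum_le fun i _ => (totalDegree_pow _ _).trans ?_
        exact Nat.mul_le_mul_left 2 ((totalDegree_sub_C_le _ _).trans (hf i))
    refine card_le_of_lt_frontier Q (by omega) hQdeg T U x (fun τ _ => hUo τ) (fun τ _ => hUb τ)
      (fun τ hτ τ' hτ' hne => ?_) hxU fun τ hτ y hy => ?_
    · refine Set.disjoint_left.2 fun y hy hy' => ?_
      obtain ⟨i, hi⟩ := Function.ne_iff.1 hne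
      have hiI : i ∉ I τ₀ := fun h => hi ((hTτ τ hτ i h).trans (hTτ τ' hτ' i h).symm)
      exact hgdisj τ τ' i y hi (hy.1 i (hTI τ hτ ▸ hiI)) (hy'.1 i (hTI τ' hτ' ▸ hiI))
    · rw [hQ, hQ, (hpenz τ hτ (x τ)).2 fun i hi => ((hxI τ (hTS τ hτ)).2.1 i).1 hi, mul_zero,
        add_zero]
      exact hM τ hτ y hy
  calc S.card ≤ (2 * s) ^ Fintype.card σ * B.card :=
        Finset.card_le_mul_card_image_of_maps_to hlab _ hfib
    _ ≤ (2 * s) ^ Fintype.card σ * (2 ^ Fintype.card σ *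
        (Finset.univ.filter fun J : Finset ι => J.card ≤ Fintype.card σ).card) :=
      Nat.mul_le_mul_left _ hBcard
    _ = _ := by rw [← mul_assoc, ← mul_pow]; ring_nf

end MvPolynomial

theorem Finset.card_filter_card_le_mul_pow_le_exp {ι : Type*} [Fintype ι] (k : ℕ)
    (hk : k ≤ Fintype.card ι) :
    ((Finset.univ.filter fun I : Finset ι => I.card ≤ k).card : ℝ) *
      (k / Fintype.card ι : ℝ) ^ k ≤ Real.exp 1 ^ k := by
  classical
  rcases Nat.eq_zero_or_pos (Fintype.card ι) with h0 | hpos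
  · have hk0 : k = 0 := by omega
    subst hk0
    have : IsEmpty ι := Fintype.card_eq_zero_iff.1 h0
    simpa using Finset.card_filter_le ({default} : Finset (Finset ι)) (· = ∅)
  set n := Fintype.card ι with hn
  have hnpos : (0 : ℝ) < n := by exact_mod_cast hpos
  set a : ℝ := k / n with ha
  have ha0 : 0 ≤ a := by positivity
  have ha1 : a ≤ 1 := (div_le_one hnpos).2 (by exact_mod_cast hk)
  calc _ = ∑ I ∈ Finset.univ.filter (fun I : Finset ι => I.card ≤ k), a ^ k := by simp
    _ ≤ ∑ I ∈ Finset.univ.filter (fun I : Finset ι => I.card ≤ k), a ^ I.card :=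
      Finset.sum_le_sum fun I hI =>
        pow_le_pow_of_le_one ha0 ha1 (Finset.mem_filter.1 hI).2
    _ ≤ ∑ I : Finset ι, a ^ I.card :=
      Finset.sum_le_sum_of_subset_of_nonneg (Finset.filter_subset _ _) fun _ _ _ => by positivity
    _ = (a + 1) ^ n := by simpa using Fintype.sum_pow_mul_eq_add_pow ι a 1
    _ ≤ Real.exp a ^ n := pow_le_pow_left₀ (by positivity) (Real.add_one_le_exp a) n
    _ = Real.exp 1 ^ k := by
      rw [← Real.exp_nat_mul, ← Real.exp_nat_mul, ha, mul_div_cancel₀ _ hnpos.ne', mul_one]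

theorem Real.le_two_mul_mul_logb_of_two_pow_le {n k : ℕ} {A : ℝ} (hA : 4 ≤ A) (hkn : k ≤ n)
    (h : (2 : ℝ) ^ n * (k / n : ℝ) ^ k ≤ A ^ k) : (n : ℝ) ≤ 2 * k * Real.logb 2 A := by
  rcases Nat.eq_zero_or_pos k with rfl | hk
  · have h1 : (2 : ℝ) ^ n ≤ 1 := by simpa using h
    have h2 : n = 0 := by
      by_contra hn
      exact absurd h1 (not_le.2 (one_lt_pow₀ one_lt_two hn))
    simp [h2]
  have hn : 0 < n := hk.trans_le hkn
  have hk' : (0 : ℝ) < k := by exact_mod_cast hk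
  have hn' : (0 : ℝ) < n := by exact_mod_cast hn
  have hL : 2 ≤ Real.logb 2 A := by
    rw [Real.le_logb_iff_rpow_le one_lt_two (by linarith)]
    norm_num
    exact hA
  set y : ℝ := n / k with hy
  have hy0 : 0 < y := by positivity
  have hlog : (n : ℝ) - k * Real.logb 2 y ≤ k * Real.logb 2 A := by
    have h1 := Real.logb_le_logb_of_le one_lt_two (by positivity) h
    rw [Real.logb_mul (by positivity) (by positivity), Real.logb_pow, Real.logb_pow,
      Real.logb_pow, Real.logb_self_eq_one one_lt_two, ← inv_div, Real.logb_inv] at h1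
    rw [hy]
    linarith
  have hny : (n : ℝ) = k * y := by rw [hy]; field_simp
  rcases le_total y 4 with hy4 | hy4
  · rw [hny]
    nlinarith
  · have hlogy : Real.logb 2 y ≤ y / 2 := by
      have h1 : Real.logb 2 y = 2 + Real.logb 2 (y / 4) := by
        rw [Real.logb_div hy0.ne' (by norm_num)]
        have : Real.logb 2 4 = 2 := by
          rw [show (4 : ℝ) = 2 ^ 2 by norm_num, Real.logb_pow,
            Real.logb_self_eq_one one_lt_two]
          norm_num
        rw [this]; ring
      have h2 : Real.log (y / 4) ≤ y / 4 - 1 := Real.log_le_sub_one_of_pos (by positivity)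
      have h3 : Real.logb 2 (y / 4) ≤ 2 * (y / 4 - 1) := by
        rw [Real.logb, div_le_iff₀ (Real.log_pos one_lt_two)]
        nlinarith [Real.log_two_gt_d9]
      linarith
    nlinarith

/-- Karpinski–Macintyre: if `𝒞 = {A_ξ : ξ ∈ ℝᵏ}` where
`A_ξ = {z ∈ ℝᵈ : Π(z,ξ) > 0}` and, for each `z`, `Π(z,·)` is a polynomial of degree at
most `s` in the `k` components of `ξ`, then `𝒞` is a VC class with
`V(𝒞) ≤ 2 k log₂(4 e s)`: every `n` shattered by `𝒞` (i.e. with `S_n(𝒞) = 2^n`)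
satisfies `n ≤ 2 k log₂(4 e s)`. -/
theorem vc_of_polynomial_class
    (d k s : ℕ) (hs : 1 ≤ s)
    (p : (Fin d → ℝ) → MvPolynomial (Fin k) ℝ)
    (hdeg : ∀ z, (p z).totalDegree ≤ s)
    (𝒞 : Set (Set (Fin d → ℝ)))
    (h𝒞 : 𝒞 = {A | ∃ ξ : Fin k → ℝ, A = {z | 0 < MvPolynomial.eval ξ (p z)}}) :
    ∀ n : ℕ, shatterCoef 𝒞 n = 2 ^ n →
      (n : ℝ) ≤ 2 * k * Real.logb 2 (4 * Real.exp 1 * s) := by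
  classical
  intro n hn
  have hA : (4 : ℝ) ≤ 4 * Real.exp 1 * s := by
    have h1 : (1 : ℝ) ≤ Real.exp 1 := Real.one_le_exp zero_le_one
    have h2 : (1 : ℝ) ≤ s := by exact_mod_cast hs
    nlinarith
  rcases lt_or_ge n k with hnk | hkn
  · have hL : 2 ≤ Real.logb 2 (4 * Real.exp 1 * s) := by
      rw [Real.le_logb_iff_rpow_le one_lt_two (by linarith)]
      norm_num
      exact hA
    have hnk' : (n : ℝ) ≤ k := by exact_mod_cast hnk.le
    nlinarith [(Nat.cast_nonneg k : (0 : ℝ) ≤ k)]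
  refine Real.le_two_mul_mul_logb_of_two_pow_le hA hkn ?_
  have hcount : 2 ^ n ≤ (4 * s) ^ k *
      (Finset.univ.filter fun I : Finset (Fin n) => I.card ≤ k).card := by
    rw [← hn, shatterCoef]
    refine ciSup_le' fun z => ?_
    rw [Set.ncard_eq_toFinset_card']
    have := MvPolynomial.card_signPatterns_le hs (fun i => p (z i)) (fun i => hdeg (z i))
      {f : Fin n → Bool | ∃ A ∈ 𝒞, ∀ i, f i = true ↔ z i ∈ A}.toFinset fun τ hτ => by
        obtain ⟨A, hA, hτA⟩ := Set.mem_toFinset.1 hτ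
        rw [h𝒞] at hA
        obtain ⟨ξ, rfl⟩ := hA
        exact ⟨ξ, hτA⟩
    simpa using this
  have hsum := Finset.card_filter_card_le_mul_pow_le_exp (ι := Fin n) k (by simpa using hkn)
  rw [Fintype.card_fin] at hsum
  have hcount' : (2 : ℝ) ^ n ≤ (4 * s) ^ k *
      ((Finset.univ.filter fun I : Finset (Fin n) => I.card ≤ k).card : ℝ) := by
    exact_mod_cast hcount
  calc (2 : ℝ) ^ n * (k / n : ℝ) ^ k
      ≤ (4 * s) ^ k * ((Finset.univ.filter fun I : Finset (Fin n) => I.card ≤ k).card : ℝ) *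
        (k / n : ℝ) ^ k := mul_le_mul_of_nonneg_right hcount' (by positivity)
    _ = (4 * s) ^ k * (((Finset.univ.filter fun I : Finset (Fin n) => I.card ≤ k).card : ℝ) *
        (k / n : ℝ) ^ k) := mul_assoc _ _ _
    _ ≤ (4 * s) ^ k * Real.exp 1 ^ k := mul_le_mul_of_nonneg_left hsum (by positivity)
    _ = (4 * Real.exp 1 * s) ^ k := by rw [← mul_pow]; ring_nf
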